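/- Let E ⊂ ℝ^{2N} be measurable, ε ∈ (0,1), 1 ≤ p ≤ ∞, ω a weight function with constant K, g ∈ 𝒮_ω(ℝᴺ) nonzero. If there exist nonzero f ∈ 𝒮_ω(ℝᴺ) and λ ≥ 0 with ∫_E e^{λω(x,ξ)} |Sp_g f(x,ξ)| dx dξ ≥ (1−ε) (2π)^{−N} e^{K(1+2K)λ} ‖e^{2K²λω} Rf‖_p ‖e^{2K²λω} Rg‖_{p'}, then m(E) ≥ 1 − ε. -/

import Mathlib

open MeasureTheory Complex ENNReal

noncomputable section

abbrev RN (N : ℕ) := Fin N → ℝ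

def dotR {N : ℕ} (x y : RN N) : ℝ := ∑ i, x i * y i

def stft {N : ℕ} (g f : RN N → ℂ) (x ξ : RN N) : ℂ :=
  ∫ y, f y * (starRingEnd ℂ) (g (y - x)) * Complex.exp (-(Complex.I * (dotR y ξ : ℂ)))

def ftr {N : ℕ} (f : RN N → ℂ) (ξ : RN N) : ℂ :=
  ∫ x, Complex.exp (-(Complex.I * (dotR x ξ : ℂ))) * f x

def rihaczek {N : ℕ} (f : RN N → ℂ) (x ξ : RN N) : ℂ :=
  Complex.exp (-(Complex.I * (dotR x ξ : ℂ))) * f x * (starRingEnd ℂ) (ftr f ξ)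

def spec {N : ℕ} (g f : RN N → ℂ) (x ξ : RN N) : ℝ := ‖stft g f x ξ‖ ^ 2

def wig {N : ℕ} (τ : ℝ) (f : RN N → ℂ) (x ξ : RN N) : ℂ :=
  ∫ t, Complex.exp (-(Complex.I * (dotR t ξ : ℂ))) * f (x + τ • t) *
    (starRingEnd ℂ) (f (x - (1 - τ) • t))

structure WeightFunction where
  w : ℝ → ℝ
  K : ℝ
  a : ℝ
  b : ℝ
  oneLeK : 1 ≤ K
  bpos : 0 < b
  cont : Continuous w
  mono : MonotoneOn w (Set.Ici 0)
  nonneg : ∀ t, 0 ≤ w t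
  alpha : ∀ t, 0 ≤ t → w (2 * t) ≤ K * (1 + w t)
  beta : Filter.Tendsto (fun t => w t / t) Filter.atTop (nhds 0)
  gamma : ∀ t, 0 ≤ t → a + b * Real.log (1 + t) ≤ w t
  delta : ConvexOn ℝ Set.univ (fun t => w (Real.exp t))
  subadd : ∀ s t, 0 ≤ s → 0 ≤ t → w (s + t) ≤ K * (1 + w s + w t)

def wnorm (W : WeightFunction) (lam : ℝ) {E : Type*} [NormedAddCommGroup E]
    [MeasurableSpace E] (μ : Measure E) {F : Type*} [NormedAddCommGroup F]
    (f : E → F) (p : ℝ≥0∞) : ℝ≥0∞ :=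
  eLpNorm (fun t => Real.exp (lam * W.w ‖t‖) * ‖f t‖) p μ

def SOmega {N : ℕ} (W : WeightFunction) (f : RN N → ℂ) : Prop :=
  ∀ lam : ℝ, 0 < lam →
    (∃ C, ∀ x, Real.exp (lam * W.w ‖x‖) * ‖f x‖ ≤ C) ∧
    (∃ C, ∀ ξ, Real.exp (lam * W.w ‖ξ‖) * ‖ftr f ξ‖ ≤ C)

def elpN {α : Type*} [MeasurableSpace α] (μ : Measure α) (h : α → ℝ≥0∞) (p : ℝ≥0∞) : ℝ≥0∞ :=
  if p = ∞ then essSup h μ else (∫⁻ z, (h z) ^ p.toReal ∂μ) ^ (1 / p.toReal)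

end

theorem norm_exp_neg_I_mul (r : ℝ) : ‖Complex.exp (-(Complex.I * (r : ℂ)))‖ = 1 := by
  simp [Complex.norm_exp]

theorem continuous_dotR {N : ℕ} : Continuous fun z : RN N × RN N => dotR z.1 z.2 := by
  unfold dotR
  fun_prop

theorem continuous_ftr {N : ℕ} {f : RN N → ℂ} (hf : Integrable f) (hc : Continuous f) :
    Continuous (ftr f) := by
  refine continuous_of_dominated (bound := fun x => ‖f x‖) (fun ξ => ?_) (fun ξ => ?_) hf.norm ?_
  · have : Continuous fun x : RN N => dotR x ξ :=
      continuous_dotR.comp (continuous_id.prodMk continuous_const)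
    exact Continuous.aestronglyMeasurable (by fun_prop)
  · exact .of_forall fun x => by rw [norm_mul, norm_exp_neg_I_mul, one_mul]
  · refine .of_forall fun x => ?_
    have : Continuous fun ξ : RN N => dotR x ξ :=
      continuous_dotR.comp (continuous_const.prodMk continuous_id)
    fun_prop

theorem fourier_comp_ofLp {N : ℕ} (f : RN N → ℂ) (w : EuclideanSpace ℝ (Fin N)) :
    FourierTransform.fourier (fun v : EuclideanSpace ℝ (Fin N) => f v.ofLp) w =
      ftr f ((2 * Real.pi) • w.ofLp) := by
  rw [Real.fourier_eq', ftr, ← (EuclideanSpace.volume_preserving_symm_measurableEquiv_toLp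
    (Fin N)).integral_comp (MeasurableEquiv.measurableEmbedding _)]
  refine integral_congr_ae (.of_forall fun v => ?_)
  simp only [smul_eq_mul]
  congr 2
  simp [dotR, PiLp.inner_apply, Finset.mul_sum, Finset.sum_mul]
  refine Finset.sum_congr rfl fun i _ => ?_
  ring

theorem eq_integral_ftr {N : ℕ} {f : RN N → ℂ} (hf : Integrable f) (hc : Continuous f)
    (hF : Integrable (ftr f)) (y : RN N) :
    f y = (((2 * Real.pi) ^ N)⁻¹ : ℝ) •
      ∫ η, Complex.exp (Complex.I * (dotR y η : ℂ)) * ftr f η := by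
  have mp := EuclideanSpace.volume_preserving_symm_measurableEquiv_toLp (Fin N)
  have emb := (MeasurableEquiv.toLp 2 (Fin N → ℝ)).symm.measurableEmbedding
  have hpi : (2 * Real.pi) ≠ 0 := by positivity
  set F : EuclideanSpace ℝ (Fin N) → ℂ := fun v => f v.ofLp with hFdef
  have h1 : Integrable F := (mp.integrable_comp_emb emb).2 hf
  have h2 : Integrable (FourierTransform.fourier F) := by
    have : FourierTransform.fourier F =
      (fun ξ : RN N => ftr f ((2 * Real.pi) • ξ)) ∘ (MeasurableEquiv.toLp 2 (Fin N → ℝ)).symm := by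
      ext w; exact fourier_comp_ofLp f w
    rw [this, mp.integrable_comp_emb emb]
    exact (integrable_comp_smul_iff volume _ hpi).2 hF
  have h3 : Continuous F := by fun_prop
  have h4 := congrFun (h3.fourierInv_fourier_eq h1 h2) (WithLp.toLp 2 y)
  have h5 := Measure.integral_comp_smul (volume : Measure (RN N))
    (fun η => Complex.exp (Complex.I * (dotR y η : ℂ)) * ftr f η) (2 * Real.pi)
  simp only [Module.finrank_fin_fun] at h5
  rw [abs_of_nonneg (by positivity)] at h5
  rw [← h5, ← mp.integral_comp emb]
  refine Eq.trans h4.symm ?_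
  rw [Real.fourierInv_eq']
  refine integral_congr_ae (.of_forall fun v => ?_)
  simp only [smul_eq_mul, hFdef]
  rw [fourier_comp_ofLp]
  change _ = Complex.exp (Complex.I * (dotR y ((2 * Real.pi) • v.ofLp) : ℂ)) *
    ftr f ((2 * Real.pi) • v.ofLp)
  congr 2
  simp [dotR, PiLp.inner_apply, Finset.mul_sum, Finset.sum_mul]
  refine Finset.sum_congr rfl fun i _ => ?_
  ring

theorem stft_eq_integral_ftr {N : ℕ} {f g : RN N → ℂ} (hf : Integrable f) (hc : Continuous f)
    (hF : Integrable (ftr f)) (hg : Integrable g) (hgc : Continuous g) (x ξ : RN N) :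
    stft g f x ξ = (((2 * Real.pi) ^ N)⁻¹ : ℝ) •
      ∫ η, ftr f η * (Complex.exp (Complex.I * (dotR x (η - ξ) : ℂ)) *
        (starRingEnd ℂ) (ftr g (η - ξ))) := by
  have hFc := continuous_ftr hf hc
  have hint : Integrable (Function.uncurry fun y η : RN N =>
      Complex.exp (Complex.I * (dotR y η : ℂ)) * ftr f η *
        ((starRingEnd ℂ) (g (y - x)) * Complex.exp (-(Complex.I * (dotR y ξ : ℂ))))) := by
    have h1 : Integrable fun z : RN N × RN N => g (z.1 - x) * ftr f z.2 :=
      (hg.comp_sub_right x).mul_prod hF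
    refine h1.mono ?_ ?_
    · have := continuous_dotR (N := N)
      have h2 : Continuous fun z : RN N × RN N => dotR z.1 ξ :=
        continuous_dotR.comp (continuous_fst.prodMk continuous_const)
      refine Continuous.aestronglyMeasurable ?_
      simp only [Function.uncurry_def]
      fun_prop
    · refine .of_forall fun z => le_of_eq ?_
      simp [Function.uncurry_def, Complex.norm_exp, mul_comm]
  calc stft g f x ξ
      = ∫ y, (((2 * Real.pi) ^ N)⁻¹ : ℝ) • ∫ η, Complex.exp (Complex.I * (dotR y η : ℂ)) *
          ftr f η * ((starRingEnd ℂ) (g (y - x)) *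
            Complex.exp (-(Complex.I * (dotR y ξ : ℂ)))) := by
        refine integral_congr_ae (.of_forall fun y => ?_)
        simp only
        rw [eq_integral_ftr hf hc hF y, integral_mul_const, smul_mul_assoc, smul_mul_assoc,
          mul_assoc]
    _ = _ := by
        rw [integral_smul, integral_integral_swap hint]
        congr 1
        refine integral_congr_ae (.of_forall fun η => ?_)
        simp only
        rw [show ftr g (η - ξ) = ∫ y, Complex.exp (-(Complex.I * (dotR y (η - ξ) : ℂ))) * g y
          from rfl, ← integral_conj, ← integral_const_mul, ← integral_const_mul]
        refine (integral_add_right_eq_self (μ := volume) _ x).symm.trans ?_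
        refine integral_congr_ae (.of_forall fun y => ?_)
        have e : ∀ a b c d : ℂ, a + d = b + c → Complex.exp a * Complex.exp d =
          Complex.exp b * Complex.exp c := fun a b c d h => by
            rw [← Complex.exp_add, ← Complex.exp_add, h]
        have key := e (Complex.I * (dotR (y + x) η : ℂ)) (Complex.I * (dotR x (η - ξ) : ℂ))
          (Complex.I * (dotR y (η - ξ) : ℂ)) (-(Complex.I * (dotR (y + x) ξ : ℂ))) (by
            simp only [dotR, Pi.add_apply, Pi.sub_apply, add_mul, mul_sub, Finset.sum_add_distrib,
              Finset.sum_sub_distrib]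
            push_cast
            ring)
        simp only [add_sub_cancel_right, map_mul, ← Complex.exp_conj, map_neg, Complex.conj_I,
          Complex.conj_ofReal, neg_mul, neg_neg]
        linear_combination (ftr f η * (starRingEnd ℂ) (g y)) * key

theorem enorm_rihaczek {N : ℕ} (f : RN N → ℂ) (x ξ : RN N) :
    ‖rihaczek f x ξ‖ₑ = ‖f x‖ₑ * ‖ftr f ξ‖ₑ := by
  rw [← ofReal_norm, rihaczek, norm_mul, norm_mul, norm_exp_neg_I_mul, one_mul, RCLike.norm_conj,
    ENNReal.ofReal_mul (norm_nonneg _), ofReal_norm, ofReal_norm]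

theorem ofReal_spec_le {N : ℕ} {f g : RN N → ℂ} (hf : Integrable f) (hc : Continuous f)
    (hF : Integrable (ftr f)) (hg : Integrable g) (hgc : Continuous g) (z : RN N × RN N) :
    ENNReal.ofReal (spec g f z.1 z.2) ≤ ENNReal.ofReal ((2 * Real.pi) ^ N)⁻¹ *
      ∫⁻ z' : RN N × RN N, ‖rihaczek f z'.1 z'.2‖ₑ * ‖rihaczek g (z' - z).1 (z' - z).2‖ₑ := by
  have hFc := continuous_ftr hf hc
  have hGc := continuous_ftr hg hgc
  have h1 : ‖stft g f z.1 z.2‖ₑ ≤ ∫⁻ y, ‖f y‖ₑ * ‖g (y - z.1)‖ₑ := by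
    refine (enorm_integral_le_lintegral_enorm _).trans_eq (lintegral_congr fun y => ?_)
    rw [← ofReal_norm, norm_mul, norm_mul, norm_exp_neg_I_mul, mul_one, RCLike.norm_conj,
      ENNReal.ofReal_mul (norm_nonneg _), ofReal_norm, ofReal_norm]
  have h2 : ‖stft g f z.1 z.2‖ₑ ≤ ENNReal.ofReal ((2 * Real.pi) ^ N)⁻¹ *
      ∫⁻ η, ‖ftr f η‖ₑ * ‖ftr g (η - z.2)‖ₑ := by
    rw [stft_eq_integral_ftr hf hc hF hg hgc, enorm_smul,
      Real.enorm_of_nonneg (by positivity)]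
    gcongr
    refine (enorm_integral_le_lintegral_enorm _).trans_eq (lintegral_congr fun η => ?_)
    rw [← ofReal_norm, norm_mul, norm_mul, RCLike.norm_conj, mul_comm Complex.I,
      Complex.norm_exp_ofReal_mul_I, one_mul,
      ENNReal.ofReal_mul (norm_nonneg _), ofReal_norm, ofReal_norm]
  calc ENNReal.ofReal (spec g f z.1 z.2)
      = ‖stft g f z.1 z.2‖ₑ * ‖stft g f z.1 z.2‖ₑ := by
        rw [spec, sq, ENNReal.ofReal_mul (norm_nonneg _), ofReal_norm]
    _ ≤ _ := mul_le_mul' h1 h2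
    _ = ENNReal.ofReal ((2 * Real.pi) ^ N)⁻¹ * ((∫⁻ y, ‖f y‖ₑ * ‖g (y - z.1)‖ₑ) *
          ∫⁻ η, ‖ftr f η‖ₑ * ‖ftr g (η - z.2)‖ₑ) := by ring
    _ = _ := by
        congr 1
        rw [← lintegral_prod_mul (by fun_prop) (by fun_prop)]
        refine lintegral_congr fun z' => ?_
        simp only [enorm_rihaczek, Prod.fst_sub, Prod.snd_sub]
        ring

theorem lintegral_enorm_mul_le_eLpNorm_mul_eLpNorm {α : Type*} [MeasurableSpace α] {μ : Measure α}
    {u v : α → ℝ} {p q : ℝ≥0∞} (hu : AEStronglyMeasurable u μ) (hv : AEStronglyMeasurable v μ)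
    (hpq : p⁻¹ + q⁻¹ = 1) : ∫⁻ z, ‖u z‖ₑ * ‖v z‖ₑ ∂μ ≤ eLpNorm u p μ * eLpNorm v q μ := by
  have : ENNReal.HolderTriple p q 1 := ⟨by simpa using hpq⟩
  have h := eLpNorm_le_eLpNorm_mul_eLpNorm'_of_norm (p := p) (q := q) (r := 1) hu hv (fun a b : ℝ => a * b) 1
    (.of_forall fun z => by simp [norm_mul])
  simpa [eLpNorm_one_eq_lintegral_enorm, enorm_mul] using h

theorem WeightFunction.le_of_norm_sub (W : WeightFunction) {E : Type*} [NormedAddCommGroup E]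
    (z z' : E) : W.w ‖z‖ ≤ W.K * (1 + W.w ‖z'‖ + W.w ‖z' - z‖) := by
  refine le_trans (W.mono (norm_nonneg _) (Set.mem_Ici.2 (by positivity)) ?_)
    (W.subadd _ _ (norm_nonneg z') (norm_nonneg (z' - z)))
  calc ‖z‖ = ‖z' - (z' - z)‖ := by congr 1; abel
    _ ≤ _ := norm_sub_le _ _

theorem WeightFunction.exp_le (W : WeightFunction) {E : Type*} [NormedAddCommGroup E]
    {lam : ℝ} (hlam : 0 ≤ lam) (z z' : E) :
    Real.exp (lam * W.w ‖z‖) ≤ Real.exp (W.K * (1 + 2 * W.K) * lam) *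
      (Real.exp (2 * W.K ^ 2 * lam * W.w ‖z'‖) *
        Real.exp (2 * W.K ^ 2 * lam * W.w ‖z' - z‖)) := by
  rw [← Real.exp_add, ← Real.exp_add, Real.exp_le_exp]
  have hK := W.oneLeK
  have h1 := mul_le_mul_of_nonneg_left (W.le_of_norm_sub z z') hlam
  have h2 : W.K ≤ 2 * W.K ^ 2 := by nlinarith
  have h3 : ∀ t, W.K * (lam * W.w t) ≤ 2 * W.K ^ 2 * (lam * W.w t) := fun t =>
    mul_le_mul_of_nonneg_right h2 (mul_nonneg hlam (W.nonneg t))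
  have h4 : 0 ≤ 2 * W.K ^ 2 * lam := by positivity
  linarith [h3 ‖z'‖, h3 ‖z' - z‖]

theorem continuous_exp_mul_norm_rihaczek {N : ℕ} (W : WeightFunction) (c : ℝ) {f : RN N → ℂ}
    (hf : Integrable f) (hc : Continuous f) :
    Continuous fun z : RN N × RN N => Real.exp (c * W.w ‖z‖) * ‖rihaczek f z.1 z.2‖ := by
  have hF := continuous_ftr hf hc
  have hw := W.cont
  have hd := continuous_dotR (N := N)
  unfold rihaczek
  fun_prop

theorem isAddHaarMeasure_volume_prod (N : ℕ) :
    (volume : Measure (RN N × RN N)).IsAddHaarMeasure :=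
  Measure.prod.instIsAddHaarMeasure _ _

theorem ofReal_exp_mul_spec_le {N : ℕ} (W : WeightFunction) {p q : ℝ≥0∞} (hpq : p⁻¹ + q⁻¹ = 1)
    {f g : RN N → ℂ} (hf : Integrable f) (hc : Continuous f)
    (hF : Integrable (ftr f)) (hg : Integrable g) (hgc : Continuous g)
    {lam : ℝ} (hlam : 0 ≤ lam) (z : RN N × RN N) :
    ENNReal.ofReal (Real.exp (lam * W.w ‖z‖) * spec g f z.1 z.2) ≤
      ENNReal.ofReal (((2 * Real.pi) ^ N)⁻¹ * Real.exp (W.K * (1 + 2 * W.K) * lam)) *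
        (wnorm W (2 * W.K ^ 2 * lam) volume (fun z : RN N × RN N => rihaczek f z.1 z.2) p *
          wnorm W (2 * W.K ^ 2 * lam) volume (fun z : RN N × RN N => rihaczek g z.1 z.2) q) := by
  have hA := continuous_exp_mul_norm_rihaczek W (2 * W.K ^ 2 * lam) hf hc
  have hB := continuous_exp_mul_norm_rihaczek W (2 * W.K ^ 2 * lam) hg hgc
  have := isAddHaarMeasure_volume_prod N
  have hshift := measurePreserving_sub_right (volume : Measure (RN N × RN N)) z
  unfold wnorm
  rw [← eLpNorm_comp_measurePreserving hB.aestronglyMeasurable hshift]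
  refine le_trans ?_ (mul_le_mul_right (lintegral_enorm_mul_le_eLpNorm_mul_eLpNorm
    hA.aestronglyMeasurable
    (hB.comp (continuous_sub_right z)).aestronglyMeasurable hpq) _)
  rw [ENNReal.ofReal_mul (Real.exp_pos _).le, ENNReal.ofReal_mul (by positivity)]
  refine (mul_le_mul_right (ofReal_spec_le hf hc hF hg hgc z) _).trans ?_
  rw [mul_left_comm, mul_assoc]
  refine mul_le_mul_right ?_ _
  rw [← lintegral_const_mul' _ _ ENNReal.ofReal_ne_top,
    ← lintegral_const_mul' _ _ ENNReal.ofReal_ne_top]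
  refine lintegral_mono fun z' => ?_
  have h := ENNReal.ofReal_le_ofReal (W.exp_le hlam z z')
  rw [ENNReal.ofReal_mul (Real.exp_pos _).le, ENNReal.ofReal_mul (Real.exp_pos _).le] at h
  refine (mul_le_mul_left h _).trans_eq ?_
  simp only [Function.comp_apply, enorm_mul, enorm_norm, Real.enorm_of_nonneg (Real.exp_pos _).le]
  ring

theorem WeightFunction.exists_bound_rpow (W : WeightFunction) {E F : Type*} [NormedAddCommGroup E]
    [NormedAddCommGroup F] {h : E → F} {c r C : ℝ} (hr : 0 ≤ r)
    (hC : ∀ x, Real.exp ((c + r / W.b) * W.w ‖x‖) * ‖h x‖ ≤ C) :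
    ∃ C', ∀ x, Real.exp (c * W.w ‖x‖) * ‖h x‖ ≤ C' * (1 + ‖x‖) ^ (-r) := by
  have hb := W.bpos
  refine ⟨C * Real.exp (-(r / W.b * W.a)), fun x => ?_⟩
  have hpos : 0 < 1 + ‖x‖ := by positivity
  have h1 : Real.exp (-(r / W.b * W.w ‖x‖)) ≤
      Real.exp (-(r / W.b * W.a)) * (1 + ‖x‖) ^ (-r) := by
    rw [Real.rpow_def_of_pos hpos, ← Real.exp_add, Real.exp_le_exp]
    have h2 := mul_le_mul_of_nonneg_left (W.gamma ‖x‖ (norm_nonneg x))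
      (show 0 ≤ r / W.b by positivity)
    have h3 : r / W.b * (W.a + W.b * Real.log (1 + ‖x‖)) =
      r / W.b * W.a + r * Real.log (1 + ‖x‖) := by field_simp
    linarith
  have hC0 : 0 ≤ C := le_trans (by positivity) (hC x)
  calc Real.exp (c * W.w ‖x‖) * ‖h x‖
      = Real.exp ((c + r / W.b) * W.w ‖x‖) * ‖h x‖ * Real.exp (-(r / W.b * W.w ‖x‖)) := by
        rw [mul_right_comm, ← Real.exp_add]
        ring_nf
    _ ≤ C * (Real.exp (-(r / W.b * W.a)) * (1 + ‖x‖) ^ (-r)) :=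
        mul_le_mul (hC x) h1 (Real.exp_pos _).le hC0
    _ = _ := by ring

theorem memLp_one_add_norm_rpow {E : Type*} [NormedAddCommGroup E] [NormedSpace ℝ E]
    [FiniteDimensional ℝ E] [MeasurableSpace E] [BorelSpace E] (μ : Measure E)
    [μ.IsAddHaarMeasure] {r : ℝ} (hr : (Module.finrank ℝ E : ℝ) < r) {p : ℝ≥0∞} (hp : 1 ≤ p) :
    MemLp (fun x : E => (1 + ‖x‖) ^ (-r)) p μ := by
  have hr0 : 0 < r := (Nat.cast_nonneg _).trans_lt hr
  have hm : AEStronglyMeasurable (fun x : E => (1 + ‖x‖) ^ (-r)) μ :=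
    (show Measurable fun x : E => (1 + ‖x‖) ^ (-r) by fun_prop).aestronglyMeasurable
  have hle : ∀ x : E, ‖(1 + ‖x‖) ^ (-r)‖ ≤ 1 := fun x => by
    rw [Real.norm_of_nonneg (by positivity)]
    exact Real.rpow_le_one_of_one_le_of_nonpos (by linarith [norm_nonneg x]) (by linarith)
  by_cases htop : p = ∞
  · subst htop
    exact memLp_top_of_bound hm 1 (.of_forall hle)
  · have hp0 : p ≠ 0 := (zero_lt_one.trans_le hp).ne'
    rw [← integrable_norm_rpow_iff hm hp0 htop]
    have hp1 : 1 ≤ p.toReal := by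
      rw [← ENNReal.toReal_one]
      exact ENNReal.toReal_mono htop hp
    refine (integrable_one_add_norm hr).norm.mono'
      (hm.norm.aemeasurable.pow_const _).aestronglyMeasurable (.of_forall fun x => ?_)
    rw [Real.norm_of_nonneg (by positivity)]
    exact Real.rpow_le_self_of_le_one (norm_nonneg _) (hle x) hp1

theorem SOmega.integrable_ftr {N : ℕ} {W : WeightFunction} {f : RN N → ℂ} (h : SOmega W f)
    (hf : Integrable f) (hc : Continuous f) : Integrable (ftr f) := by
  have hb := W.bpos
  obtain ⟨C, hC⟩ := (h ((N + 1) / W.b) (by positivity)).2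
  obtain ⟨C', hC'⟩ := W.exists_bound_rpow (h := ftr f) (c := 0) (r := N + 1) (by positivity)
    (by simpa using hC)
  refine ((integrable_one_add_norm (r := N + 1) (by simp)).const_mul C').mono'
    (continuous_ftr hf hc).aestronglyMeasurable (.of_forall fun x => ?_)
  simpa using hC' x

theorem SOmega.wnorm_rihaczek_ne_top {N : ℕ} {W : WeightFunction} {f : RN N → ℂ} (h : SOmega W f)
    (hf : Integrable f) (hc : Continuous f) {c : ℝ} (hc0 : 0 ≤ c) {p : ℝ≥0∞} (hp : 1 ≤ p) :
    wnorm W c volume (fun z : RN N × RN N => rihaczek f z.1 z.2) p ≠ ∞ := by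
  have hb := W.bpos
  set r : ℝ := Module.finrank ℝ (RN N × RN N) + 1 with hr
  have hr0 : 0 < r := by positivity
  obtain ⟨⟨C₁, hC₁⟩, C₂, hC₂⟩ := h (c + r / W.b) (by positivity)
  have hbound : ∀ z : RN N × RN N,
      Real.exp ((c + r / W.b) * W.w ‖z‖) * ‖rihaczek f z.1 z.2‖ ≤ C₁ * C₂ := fun z => by
    have hw : W.w ‖z‖ ≤ W.w ‖z.1‖ + W.w ‖z.2‖ := by
      rw [Prod.norm_def]
      rcases max_choice ‖z.1‖ ‖z.2‖ with h' | h' <;> rw [h'] <;>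
        linarith [W.nonneg ‖z.1‖, W.nonneg ‖z.2‖]
    have hR : ‖rihaczek f z.1 z.2‖ = ‖f z.1‖ * ‖ftr f z.2‖ := by
      rw [rihaczek, norm_mul, norm_mul, norm_exp_neg_I_mul, one_mul, RCLike.norm_conj]
    calc Real.exp ((c + r / W.b) * W.w ‖z‖) * ‖rihaczek f z.1 z.2‖
        ≤ Real.exp ((c + r / W.b) * (W.w ‖z.1‖ + W.w ‖z.2‖)) * (‖f z.1‖ * ‖ftr f z.2‖) := by
          rw [hR]
          gcongr
      _ = (Real.exp ((c + r / W.b) * W.w ‖z.1‖) * ‖f z.1‖) *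
            (Real.exp ((c + r / W.b) * W.w ‖z.2‖) * ‖ftr f z.2‖) := by
          rw [mul_add, Real.exp_add]
          ring
      _ ≤ C₁ * C₂ := mul_le_mul (hC₁ _) (hC₂ _) (by positivity)
          (le_trans (by positivity) (hC₁ z.1))
  obtain ⟨C', hC'⟩ := W.exists_bound_rpow (h := fun z : RN N × RN N => rihaczek f z.1 z.2)
    hr0.le hbound
  have := isAddHaarMeasure_volume_prod N
  refine (MemLp.of_le_mul (c := C') (memLp_one_add_norm_rpow volume (r := r) (by simp [hr]) hp)
    (continuous_exp_mul_norm_rihaczek W c hf hc).aestronglyMeasurable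
    (.of_forall fun z => ?_)).eLpNorm_ne_top
  rw [Real.norm_of_nonneg (by positivity), Real.norm_of_nonneg (by positivity)]
  exact hC' z

theorem wnorm_rihaczek_ne_zero {N : ℕ} (W : WeightFunction) {f : RN N → ℂ}
    (hf : Integrable f) (hc : Continuous f) (hF : Integrable (ftr f)) (hf0 : f ≠ 0)
    (c : ℝ) {p : ℝ≥0∞} (hp : p ≠ 0) :
    wnorm W c volume (fun z : RN N × RN N => rihaczek f z.1 z.2) p ≠ 0 := by
  have hcont := continuous_exp_mul_norm_rihaczek W c hf hc
  intro h0
  rw [wnorm, eLpNorm_eq_zero_iff hcont.aestronglyMeasurable hp] at h0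
  have hz := Continuous.ae_eq_iff_eq volume hcont continuous_zero |>.1 h0
  obtain ⟨x, hx⟩ := Function.ne_iff.1 hf0
  refine hf0 (funext fun y => ?_)
  have hFz : ∀ ξ, ftr f ξ = 0 := fun ξ => by
    have := congrFun hz (x, ξ)
    simpa [rihaczek, Complex.exp_ne_zero, Real.exp_ne_zero, show f x ≠ 0 from hx] using this
  rw [eq_integral_ftr hf hc hF y]
  simp [hFz]

theorem stmt14 {N : ℕ} (W : WeightFunction) (E : Set (RN N × RN N)) (hE : MeasurableSet E)
    (ε : ℝ) (hε : ε ∈ Set.Ioo (0 : ℝ) 1)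
    (p q : ℝ≥0∞) (hp : 1 ≤ p) (hpq : 1 / p + 1 / q = 1)
    (g : SchwartzMap (RN N) ℂ) (hg : SOmega W ⇑g) (hg0 : ⇑g ≠ 0)
    (f : SchwartzMap (RN N) ℂ) (hf : SOmega W ⇑f) (hf0 : ⇑f ≠ 0)
    (lam : ℝ) (hlam : 0 ≤ lam)
    (h : ENNReal.ofReal ((1 - ε) * (((2 * Real.pi) ^ N)⁻¹ *
          Real.exp (W.K * (1 + 2 * W.K) * lam))) *
        wnorm W (2 * W.K ^ 2 * lam) MeasureTheory.volume
          (fun z : RN N × RN N => rihaczek ⇑f z.1 z.2) p *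
        wnorm W (2 * W.K ^ 2 * lam) MeasureTheory.volume
          (fun z : RN N × RN N => rihaczek ⇑g z.1 z.2) q ≤
      ∫⁻ z in E, ENNReal.ofReal (Real.exp (lam * W.w ‖z‖) * spec ⇑g ⇑f z.1 z.2)) :
    ENNReal.ofReal (1 - ε) ≤ MeasureTheory.volume E := by
  have hpq' : p⁻¹ + q⁻¹ = 1 := by simpa using hpq
  have hq : 1 ≤ q := by
    rw [← ENNReal.inv_le_one, ← hpq']
    exact le_add_self
  have hcf := f.continuous
  have hcg := g.continuous
  have hif : Integrable ⇑f := f.integrable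
  have hig : Integrable ⇑g := g.integrable
  have hFf := hf.integrable_ftr hif hcf
  have hFg := hg.integrable_ftr hig hcg
  have hc : 0 ≤ 2 * W.K ^ 2 * lam := by positivity
  have hA := hf.wnorm_rihaczek_ne_top hif hcf hc hp
  have hB := hg.wnorm_rihaczek_ne_top hig hcg hc hq
  have hA0 := wnorm_rihaczek_ne_zero W hif hcf hFf hf0 (2 * W.K ^ 2 * lam)
    (zero_lt_one.trans_le hp).ne'
  have hB0 := wnorm_rihaczek_ne_zero W hig hcg hFg hg0 (2 * W.K ^ 2 * lam)
    (zero_lt_one.trans_le hq).ne'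
  have hup := h.trans (lintegral_mono fun z =>
    ofReal_exp_mul_spec_le W hpq' hif hcf hFf hig hcg hlam z)
  rw [setLIntegral_const, ENNReal.ofReal_mul (by linarith [hε.2]), mul_assoc, mul_assoc,
    mul_comm _ (volume E)] at hup
  refine (ENNReal.mul_le_mul_iff_left ?_ ?_).1 hup
  · exact mul_ne_zero (ENNReal.ofReal_pos.2 (by positivity)).ne' (mul_ne_zero hA0 hB0)
  · exact ENNReal.mul_ne_top ENNReal.ofReal_ne_top (ENNReal.mul_ne_top hA hB)
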